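/- arXiv:1311.3044 — 3 statements merged into one kernel-verified Lean document; each statement's English description precedes it below -/
import Mathlib

section
/- For |q|<1, ∑_{n=0}^∞ q^n (q;q²)_n / (q²;q²)_n equals ∑_{n=0}^∞ q^{n(n+1)/2}, i.e. (1/2)·∑_{n∈ℤ} q^{n(n+1)/2}. -/
open Filter Topology

/-- The quotient `(q;q²)_n / (q²;q²)_n`. -/
noncomputable def oddEvenRatio (q : ℂ) (n : ℕ) : ℂ :=
  (∏ j ∈ Finset.range n, (1 - q ^ (2 * j + 1))) / ∏ j ∈ Finset.range n, (1 - q ^ (2 * j + 2))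

lemma one_sub_pow_ne_zero_of_norm_lt_one {q : ℂ} (hq : ‖q‖ < 1) {k : ℕ} (hk : k ≠ 0) :
    1 - q ^ k ≠ 0 := by
  intro h
  have h1 : ‖q ^ k‖ = 1 := by rw [← sub_eq_zero.mp h, norm_one]
  rw [norm_pow] at h1
  exact (pow_lt_one₀ (norm_nonneg q) hq hk).ne h1

lemma oddEvenRatio_zero (q : ℂ) : oddEvenRatio q 0 = 1 := by simp [oddEvenRatio]

lemma oddEvenRatio_succ (q : ℂ) (n : ℕ) :
    oddEvenRatio q (n + 1) =
      oddEvenRatio q n * ((1 - q ^ (2 * n + 1)) / (1 - q ^ (2 * n + 2))) := by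
  simp only [oddEvenRatio, Finset.prod_range_succ, mul_div_mul_comm]

lemma oddEvenRatio_ne_zero {q : ℂ} (hq : ‖q‖ < 1) (n : ℕ) : oddEvenRatio q n ≠ 0 :=
  div_ne_zero
    (Finset.prod_ne_zero_iff.mpr fun _ _ => one_sub_pow_ne_zero_of_norm_lt_one hq (by omega))
    (Finset.prod_ne_zero_iff.mpr fun _ _ => one_sub_pow_ne_zero_of_norm_lt_one hq (by omega))

lemma oddEvenRatio_succ_mul {q : ℂ} (hq : ‖q‖ < 1) (n : ℕ) :
    oddEvenRatio q (n + 1) * (1 - q ^ (2 * n + 2)) =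
      oddEvenRatio q n * (1 - q ^ (2 * n + 1)) := by
  have h := one_sub_pow_ne_zero_of_norm_lt_one hq (k := 2 * n + 2) (by omega)
  rw [oddEvenRatio_succ]
  field_simp

/-- The functional equation of `∑ (q;q²)_s / (q²;q²)_s z^s`, truncated at order `n`. -/
lemma sum_oddEvenRatio_functional_eq {q : ℂ} (hq : ‖q‖ < 1) (z : ℂ) (n : ℕ) :
    (1 - z) * ∑ s ∈ Finset.range n, oddEvenRatio q s * z ^ s =
      (1 - q * z) * (∑ s ∈ Finset.range n, oddEvenRatio q s * (q ^ 2 * z) ^ s) -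
        oddEvenRatio q n * (1 - q ^ (2 * n)) * z ^ n := by
  induction n with
  | zero => simp
  | succ n ih =>
    rw [Finset.sum_range_succ, Finset.sum_range_succ, mul_add, ih, mul_pow,
      show 2 * (n + 1) = 2 * n + 2 by ring, oddEvenRatio_succ_mul hq]
    ring

/-- A finite form of Gauss's triangular number identity, due to Shanks. -/
lemma sum_triangular_mul_oddEvenRatio {q : ℂ} (hq : ‖q‖ < 1) (n : ℕ) :
    (∑ j ∈ Finset.range (2 * n), q ^ (j * (j + 1) / 2)) * oddEvenRatio q n =
      ∑ s ∈ Finset.range n, oddEvenRatio q s * (q ^ (2 * n + 1)) ^ s := by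
  induction n with
  | zero => simp
  | succ n ih =>
    have h2 := one_sub_pow_ne_zero_of_norm_lt_one hq (k := 2 * n + 2) (by omega)
    have key := sum_oddEvenRatio_functional_eq hq (q ^ (2 * n + 1)) n
    rw [← ih] at key
    have e1 : 2 * n * (2 * n + 1) / 2 = n * (2 * n + 1) := by
      rw [mul_assoc, Nat.mul_div_cancel_left _ two_pos]
    have e2 : (2 * n + 1) * (2 * n + 1 + 1) / 2 = (2 * n + 1) * (n + 1) := by
      rw [show (2 * n + 1) * (2 * n + 1 + 1) = 2 * ((2 * n + 1) * (n + 1)) by ring,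
        Nat.mul_div_cancel_left _ two_pos]
    rw [show 2 * (n + 1) = 2 * n + 1 + 1 by ring, Finset.sum_range_succ, Finset.sum_range_succ,
      Finset.sum_range_succ _ n, e1, e2,
      show q ^ (2 * n + 1 + 1 + 1) = q ^ 2 * q ^ (2 * n + 1) by ring, ← mul_right_inj' h2]
    linear_combination key + ((∑ j ∈ Finset.range (2 * n), q ^ (j * (j + 1) / 2)) +
      q ^ (n * (2 * n + 1)) + q ^ ((2 * n + 1) * (n + 1))) * oddEvenRatio_succ_mul hq n

lemma summable_oddEvenRatio {q z : ℂ} (hq : ‖q‖ < 1) (hz : ‖z‖ < 1) :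
    Summable fun s : ℕ => oddEvenRatio q s * z ^ s := by
  have hlim (c : ℕ) : Tendsto (fun n : ℕ => 1 - q ^ (2 * n + c)) atTop (𝓝 1) := by
    have h := (tendsto_pow_atTop_nhds_zero_of_norm_lt_one hq).comp
      (tendsto_atTop_mono (fun n : ℕ => (by omega : n ≤ 2 * n + c)) tendsto_id)
    simpa using h.const_sub 1
  have hratio : Tendsto (fun n : ℕ => ‖(1 - q ^ (2 * n + 1)) / (1 - q ^ (2 * n + 2)) * z‖)
      atTop (𝓝 ‖z‖) := by
    simpa using (((hlim 1).div (hlim 2) one_ne_zero).mul_const z).norm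
  obtain ⟨r, hzr, hr⟩ := exists_between hz
  refine summable_of_ratio_norm_eventually_le hr ?_
  filter_upwards [hratio.eventually_le_const hzr] with n hn
  rw [oddEvenRatio_succ, pow_succ z,
    show oddEvenRatio q n * ((1 - q ^ (2 * n + 1)) / (1 - q ^ (2 * n + 2))) * (z ^ n * z) =
      ((1 - q ^ (2 * n + 1)) / (1 - q ^ (2 * n + 2)) * z) * (oddEvenRatio q n * z ^ n) by ring,
    norm_mul]
  gcongr

lemma tsum_oddEvenRatio_functional_eq {q z : ℂ} (hq : ‖q‖ < 1) (hz : ‖z‖ < 1) :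
    (1 - z) * ∑' s : ℕ, oddEvenRatio q s * z ^ s =
      (1 - q * z) * ∑' s : ℕ, oddEvenRatio q s * (q ^ 2 * z) ^ s := by
  have hqz : ‖q ^ 2 * z‖ < 1 := by
    rw [norm_mul, norm_pow]
    exact mul_lt_one_of_nonneg_of_lt_one_right (pow_le_one₀ (norm_nonneg q) hq.le)
      (norm_nonneg z) hz
  have h1 := summable_oddEvenRatio hq hz
  have h2 := summable_oddEvenRatio hq hqz
  have hrem : Tendsto (fun n : ℕ => oddEvenRatio q n * (1 - q ^ (2 * n)) * z ^ n)
      atTop (𝓝 0) := by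
    have h := h1.tendsto_atTop_zero.sub h2.tendsto_atTop_zero
    rw [sub_zero] at h
    refine h.congr fun n => ?_
    rw [mul_pow]
    ring
  refine tendsto_nhds_unique (h1.hasSum.tendsto_sum_nat.const_mul (1 - z)) ?_
  have h := (h2.hasSum.tendsto_sum_nat.const_mul (1 - q * z)).sub hrem
  rw [sub_zero] at h
  exact h.congr fun n => (sum_oddEvenRatio_functional_eq hq z n).symm

lemma tsum_mul_oddEvenRatio {q : ℂ} (hq : ‖q‖ < 1) (n : ℕ) :
    (∑' s : ℕ, oddEvenRatio q s * q ^ s) * oddEvenRatio q n =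
      ∑' s : ℕ, oddEvenRatio q s * (q ^ (2 * n + 1)) ^ s := by
  induction n with
  | zero => simp [oddEvenRatio_zero]
  | succ n ih =>
    have h2 := one_sub_pow_ne_zero_of_norm_lt_one hq (k := 2 * n + 2) (by omega)
    have hz : ‖q ^ (2 * n + 1)‖ < 1 := by
      rw [norm_pow]
      exact pow_lt_one₀ (norm_nonneg q) hq (by omega)
    have key := tsum_oddEvenRatio_functional_eq hq hz
    rw [← ih, show 1 - q * q ^ (2 * n + 1) = 1 - q ^ (2 * n + 2) by ring,
      show q ^ 2 * q ^ (2 * n + 1) = q ^ (2 * (n + 1) + 1) by ring] at key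
    rw [← mul_right_inj' h2, ← key, oddEvenRatio_succ]
    field_simp

lemma norm_oddEvenRatio_add_le {q : ℂ} (hq : ‖q‖ < 1) (n s : ℕ) :
    ‖oddEvenRatio q (s + n)‖ ≤ (2 / (1 - ‖q‖)) ^ s * ‖oddEvenRatio q n‖ := by
  induction s with
  | zero => simp
  | succ s ih =>
    have hnum : ‖1 - q ^ (2 * (s + n) + 1)‖ ≤ 2 := by
      refine (norm_sub_le _ _).trans ?_
      rw [norm_one, norm_pow]
      linarith [pow_le_one₀ (n := 2 * (s + n) + 1) (norm_nonneg q) hq.le]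
    have hden : 1 - ‖q‖ ≤ ‖1 - q ^ (2 * (s + n) + 2)‖ := by
      have h := norm_sub_norm_le 1 (q ^ (2 * (s + n) + 2))
      rw [norm_one, norm_pow] at h
      linarith [pow_le_of_le_one (norm_nonneg q) hq.le (n := 2 * (s + n) + 2) (by omega)]
    have hpos : 0 < 1 - ‖q‖ := by linarith
    rw [show s + 1 + n = s + n + 1 by ring, oddEvenRatio_succ, norm_mul, norm_div, pow_succ]
    calc ‖oddEvenRatio q (s + n)‖ *
          (‖1 - q ^ (2 * (s + n) + 1)‖ / ‖1 - q ^ (2 * (s + n) + 2)‖)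
        ≤ ((2 / (1 - ‖q‖)) ^ s * ‖oddEvenRatio q n‖) * (2 / (1 - ‖q‖)) := by gcongr
      _ = (2 / (1 - ‖q‖)) ^ s * (2 / (1 - ‖q‖)) * ‖oddEvenRatio q n‖ := by ring

lemma norm_tsum_sub_sum_triangular_le {q : ℂ} (hq : ‖q‖ < 1) {n : ℕ}
    (hn : 2 / (1 - ‖q‖) * ‖q‖ ^ (2 * n + 1) ≤ 1 / 2) :
    ‖(∑' s : ℕ, oddEvenRatio q s * q ^ s) -
      ∑ j ∈ Finset.range (2 * n), q ^ (j * (j + 1) / 2)‖ ≤ ‖q‖ ^ n * 2 := by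
  have ha : 0 < ‖oddEvenRatio q n‖ := norm_pos_iff.mpr (oddEvenRatio_ne_zero hq n)
  have hz : ‖q ^ (2 * n + 1)‖ < 1 := by
    rw [norm_pow]
    exact pow_lt_one₀ (norm_nonneg q) hq (by omega)
  have hC : 0 ≤ 2 / (1 - ‖q‖) := div_nonneg zero_le_two (by linarith)
  refine le_of_mul_le_mul_right ?_ ha
  rw [← norm_mul, sub_mul, tsum_mul_oddEvenRatio hq, sum_triangular_mul_oddEvenRatio hq,
    ← (summable_oddEvenRatio hq hz).sum_add_tsum_nat_add n, add_sub_cancel_left]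
  refine tsum_of_norm_bounded
    (g := fun s : ℕ => ‖q‖ ^ n * (1 / 2) ^ s * ‖oddEvenRatio q n‖)
    ((hasSum_geometric_two.mul_left _).mul_right _) fun s => ?_
  have hpow : (‖q‖ ^ (2 * n + 1)) ^ n ≤ ‖q‖ ^ n := by
    rw [← pow_mul]
    exact pow_le_pow_of_le_one (norm_nonneg q) hq.le (Nat.le_mul_of_pos_left n (by omega))
  calc ‖oddEvenRatio q (s + n) * (q ^ (2 * n + 1)) ^ (s + n)‖
      = ‖oddEvenRatio q (s + n)‖ * (‖q‖ ^ (2 * n + 1)) ^ (s + n) := by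
        rw [norm_mul, norm_pow, norm_pow]
    _ ≤ ((2 / (1 - ‖q‖)) ^ s * ‖oddEvenRatio q n‖) * (‖q‖ ^ (2 * n + 1)) ^ (s + n) := by
        gcongr
        exact norm_oddEvenRatio_add_le hq n s
    _ = (‖q‖ ^ (2 * n + 1)) ^ n * (2 / (1 - ‖q‖) * ‖q‖ ^ (2 * n + 1)) ^ s *
          ‖oddEvenRatio q n‖ := by
        rw [mul_pow, pow_add]
        ring
    _ ≤ ‖q‖ ^ n * (1 / 2) ^ s * ‖oddEvenRatio q n‖ := by gcongr

lemma summable_pow_triangular {q : ℂ} (hq : ‖q‖ < 1) :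
    Summable fun n : ℕ => q ^ (n * (n + 1) / 2) := by
  refine Summable.of_norm_bounded (summable_geometric_of_lt_one (norm_nonneg q) hq) fun n => ?_
  rw [norm_pow]
  refine pow_le_pow_of_le_one (norm_nonneg q) hq.le ?_
  rw [Nat.le_div_iff_mul_le two_pos]
  rcases n with _ | n
  · simp
  · gcongr
    omega

/-- For `‖q‖ < 1`,
`∑_{n=0}^∞ q^n (q;q²)_n / (q²;q²)_n = ∑_{n=0}^∞ q^{n(n+1)/2}`. -/
theorem F3_eq_triangular (q : ℂ) (hq : ‖q‖ < 1) :
    (∑' n : ℕ, q ^ n * (∏ j ∈ Finset.range n, (1 - q ^ (2 * j + 1))) /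
      ∏ j ∈ Finset.range n, (1 - q ^ (2 * j + 2))) =
      ∑' n : ℕ, q ^ (n * (n + 1) / 2) := by
  have hterm (n : ℕ) : q ^ n * (∏ j ∈ Finset.range n, (1 - q ^ (2 * j + 1))) /
      ∏ j ∈ Finset.range n, (1 - q ^ (2 * j + 2)) = oddEvenRatio q n * q ^ n := by
    rw [oddEvenRatio, mul_div_assoc, mul_comm]
  simp_rw [hterm]
  have hpow := tendsto_pow_atTop_nhds_zero_of_lt_one (norm_nonneg q) hq
  have hsmall : ∀ᶠ n : ℕ in atTop, 2 / (1 - ‖q‖) * ‖q‖ ^ (2 * n + 1) ≤ 1 / 2 := by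
    have h := (hpow.comp (tendsto_atTop_mono (fun n : ℕ => (by omega : n ≤ 2 * n + 1))
      tendsto_id)).const_mul (2 / (1 - ‖q‖))
    rw [mul_zero] at h
    exact h.eventually_le_const one_half_pos
  have hdiff := squeeze_zero_norm' (hsmall.mono fun n => norm_tsum_sub_sum_triangular_le hq)
    (by simpa using hpow.mul_const 2)
  have hsum := (summable_pow_triangular hq).hasSum.tendsto_sum_nat.comp
    (tendsto_atTop_mono (fun n : ℕ => (by omega : n ≤ 2 * n)) tendsto_id)
  exact sub_eq_zero.mp (tendsto_nhds_unique (hsum.const_sub _) hdiff)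
end

section
/- For |q|<1, ∑_{n=0}^∞ q^{n(n+1)} / (q;q)_n² = (1/(q;q)_∞) ∑_{n=0}^∞ (−1)^n q^{n(n+1)/2}. -/
open Filter Topology

/-- The finite product `(q;q)_n`. -/
noncomputable def eulerProd (q : ℂ) (n : ℕ) : ℂ := ∏ j ∈ Finset.range n, (1 - q ^ (j + 1))

/-- The summand `q^{n(n+j)} / ((q;q)_n (q;q)_{n+k})` of a Durfee rectangle series. -/
noncomputable def durfeeTerm (q : ℂ) (k j n : ℕ) : ℂ :=
  q ^ (n * (n + j)) / (eulerProd q n * eulerProd q (n + k))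

/-- The series `∑ q^{n(n+j)} / ((q;q)_n (q;q)_{n+k})`. -/
noncomputable def durfeeSum (q : ℂ) (k j : ℕ) : ℂ := ∑' n, durfeeTerm q k j n

theorem eulerProd_succ (q : ℂ) (n : ℕ) :
    eulerProd q (n + 1) = eulerProd q n * (1 - q ^ (n + 1)) :=
  Finset.prod_range_succ _ _

theorem one_sub_pow_succ_ne_zero {q : ℂ} (hq : ‖q‖ < 1) (n : ℕ) : 1 - q ^ (n + 1) ≠ 0 := by
  intro h
  have h1 : ‖q ^ (n + 1)‖ < 1 := by
    rw [norm_pow]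
    exact pow_lt_one₀ (norm_nonneg _) hq n.succ_ne_zero
  rw [← sub_eq_zero.mp h] at h1
  simp at h1

theorem eulerProd_ne_zero {q : ℂ} (hq : ‖q‖ < 1) (n : ℕ) : eulerProd q n ≠ 0 :=
  Finset.prod_ne_zero_iff.mpr fun j _ => one_sub_pow_succ_ne_zero hq j

theorem tprod_one_sub_pow_succ_ne_zero {q : ℂ} (hq : ‖q‖ < 1) : ∏' j : ℕ, (1 - q ^ (j + 1)) ≠ 0 := by
  simp_rw [sub_eq_add_neg]
  refine tprod_one_add_ne_zero_of_summable (f := fun n : ℕ => -q ^ (n + 1)) ?_ ?_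
  · intro n
    simpa [sub_eq_add_neg] using one_sub_pow_succ_ne_zero hq n
  · simpa using (summable_nat_add_iff 1).mpr (summable_geometric_of_lt_one (norm_nonneg _) hq)

theorem tendsto_inv_eulerProd {q : ℂ} (hq : ‖q‖ < 1) :
    Tendsto (fun n => (eulerProd q n)⁻¹) atTop (𝓝 (∏' j : ℕ, (1 - q ^ (j + 1)))⁻¹) :=
  (ModularForm.multipliable_one_sub_pow hq).tendsto_prod_tprod_nat.inv₀
    (tprod_one_sub_pow_succ_ne_zero hq)

theorem exists_norm_durfeeTerm_le {q : ℂ} (hq : ‖q‖ < 1) :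
    ∃ C : ℝ, ∀ k j n, ‖durfeeTerm q k j n‖ ≤ C * ‖q‖ ^ n := by
  obtain ⟨C, hC⟩ := (tendsto_inv_eulerProd hq).norm.bddAbove_range
  have hC' : ∀ n, ‖(eulerProd q n)⁻¹‖ ≤ C := fun n => hC ⟨n, rfl⟩
  have hC0 : 0 ≤ C := (norm_nonneg _).trans (hC' 0)
  refine ⟨C * C, fun k j n => ?_⟩
  rw [durfeeTerm, div_eq_mul_inv, mul_inv, norm_mul, norm_mul, norm_pow, mul_comm]
  refine mul_le_mul (mul_le_mul (hC' _) (hC' _) (norm_nonneg _) hC0) ?_ (by positivity)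
    (by positivity)
  exact pow_le_pow_of_le_one (norm_nonneg _) hq.le (by nlinarith [Nat.le_mul_self n])

theorem summable_durfeeTerm {q : ℂ} (hq : ‖q‖ < 1) (k j : ℕ) : Summable (durfeeTerm q k j) := by
  obtain ⟨C, hC⟩ := exists_norm_durfeeTerm_le hq
  exact .of_norm_bounded ((summable_geometric_of_lt_one (norm_nonneg _) hq).mul_left C) (hC k j)

theorem exists_norm_durfeeSum_le {q : ℂ} (hq : ‖q‖ < 1) : ∃ C : ℝ, ∀ k j, ‖durfeeSum q k j‖ ≤ C := by
  obtain ⟨C, hC⟩ := exists_norm_durfeeTerm_le hq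
  exact ⟨_, fun k j => tsum_of_norm_bounded
    ((summable_geometric_of_lt_one (norm_nonneg _) hq).mul_left C).hasSum (hC k j)⟩

theorem durfeeSum_eq_sub {q : ℂ} (hq : ‖q‖ < 1) (k j : ℕ) :
    durfeeSum q k j = durfeeSum q (k + 1) j - q ^ (k + 1) * durfeeSum q (k + 1) (j + 1) := by
  rw [durfeeSum, durfeeSum, durfeeSum, ← tsum_mul_left, ← (summable_durfeeTerm hq _ _).tsum_sub
    ((summable_durfeeTerm hq _ _).mul_left _)]
  refine tsum_congr fun n => ?_
  have h1 := eulerProd_ne_zero hq n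
  have h2 := eulerProd_ne_zero hq (n + k)
  have h3 := one_sub_pow_succ_ne_zero hq (n + k)
  simp only [durfeeTerm, ← add_assoc, eulerProd_succ]
  field_simp
  ring

theorem durfeeSum_eq_add {q : ℂ} (hq : ‖q‖ < 1) (k j : ℕ) :
    durfeeSum q k j = durfeeSum q k (j + 1) + q ^ (j + 1) * durfeeSum q (k + 1) (j + 2) := by
  rw [← sub_eq_iff_eq_add', durfeeSum, durfeeSum, durfeeSum, ← tsum_mul_left,
    ← (summable_durfeeTerm hq _ _).tsum_sub (summable_durfeeTerm hq _ _),
    ((summable_durfeeTerm hq _ _).sub (summable_durfeeTerm hq _ _)).tsum_eq_zero_add]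
  have h0 : durfeeTerm q k j 0 - durfeeTerm q k (j + 1) 0 = 0 := by simp [durfeeTerm]
  rw [h0, zero_add]
  refine tsum_congr fun n => ?_
  have h1 := eulerProd_ne_zero hq n
  have h2 := eulerProd_ne_zero hq (n + (k + 1))
  have h3 := one_sub_pow_succ_ne_zero hq n
  simp only [durfeeTerm, eulerProd_succ, show n + 1 + k = n + (k + 1) by ring]
  field_simp
  ring

theorem durfeeSum_diag_succ {q : ℂ} (hq : ‖q‖ < 1) (k : ℕ) : durfeeSum q k k = durfeeSum q (k + 1) (k + 1) := by
  obtain ⟨C, hC⟩ := exists_norm_durfeeSum_le hq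
  have hrec : ∀ k, durfeeSum q k k - durfeeSum q (k + 1) (k + 1) =
      -q ^ (k + 1) * (durfeeSum q (k + 1) (k + 1) - durfeeSum q (k + 2) (k + 2)) := fun k => by
    rw [durfeeSum_eq_sub hq k k, durfeeSum_eq_add hq (k + 1) k]
    ring
  have hbound : ∀ m k, ‖durfeeSum q k k - durfeeSum q (k + 1) (k + 1)‖ ≤ ‖q‖ ^ m * (C + C) := by
    intro m
    induction m with
    | zero => exact fun k => by simpa using (norm_sub_le _ _).trans (add_le_add (hC _ _) (hC _ _))
    | succ m ih =>
      intro k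
      rw [hrec, norm_mul, norm_neg, norm_pow, pow_succ' ‖q‖ m, mul_assoc]
      refine mul_le_mul ?_ (ih _) (norm_nonneg _) (norm_nonneg _)
      exact pow_le_of_le_one (norm_nonneg _) hq.le k.succ_ne_zero
  have hlim : Tendsto (fun m => ‖q‖ ^ m * (C + C)) atTop (𝓝 0) := by
    simpa using (tendsto_pow_atTop_nhds_zero_of_lt_one (norm_nonneg _) hq).mul_const (C + C)
  exact sub_eq_zero.mp (norm_le_zero_iff.mp
    (ge_of_tendsto hlim (Eventually.of_forall fun m => hbound m k)))

theorem tendsto_durfeeSum_diag {q : ℂ} (hq : ‖q‖ < 1) :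
    Tendsto (fun k => durfeeSum q k k) atTop (𝓝 (∏' j : ℕ, (1 - q ^ (j + 1)))⁻¹) := by
  obtain ⟨C, hC⟩ := exists_norm_durfeeTerm_le hq
  have h := tendsto_tsum_of_dominated_convergence (𝓕 := atTop)
    (f := fun k n => durfeeTerm q k k n)
    (g := fun n => if n = 0 then (∏' j : ℕ, (1 - q ^ (j + 1)))⁻¹ else 0)
    ((summable_geometric_of_lt_one (norm_nonneg _) hq).mul_left C) (fun n => ?_)
    (Eventually.of_forall fun k n => hC k k n)
  · simpa only [durfeeSum, tsum_ite_eq] using h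
  · rcases n with _ | n
    · simpa [durfeeTerm, eulerProd] using tendsto_inv_eulerProd hq
    · have hpow : Tendsto (fun k => q ^ ((n + 1) * (n + 1 + k))) atTop (𝓝 0) :=
        (tendsto_pow_atTop_nhds_zero_of_norm_lt_one hq).comp
          (tendsto_atTop_mono (fun k => show k ≤ _ by nlinarith [Nat.zero_le (n * k)]) tendsto_id)
      have hinv : Tendsto (fun k => (eulerProd q (n + 1 + k))⁻¹) atTop
          (𝓝 (∏' j : ℕ, (1 - q ^ (j + 1)))⁻¹) :=
        (tendsto_inv_eulerProd hq).comp (tendsto_atTop_mono (fun k => by simp) tendsto_id)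
      simpa [durfeeTerm, div_eq_mul_inv, mul_inv] using
        hpow.mul (hinv.mul_const (eulerProd q (n + 1))⁻¹)

theorem durfeeSum_diag {q : ℂ} (hq : ‖q‖ < 1) (k : ℕ) : durfeeSum q k k = (∏' j : ℕ, (1 - q ^ (j + 1)))⁻¹ := by
  have hconst : ∀ k, durfeeSum q k k = durfeeSum q 0 0 := fun k => by
    induction k with
    | zero => rfl
    | succ k ih => rw [← durfeeSum_diag_succ hq, ih]
  refine tendsto_nhds_unique ?_ (tendsto_durfeeSum_diag hq)
  simp_rw [hconst]
  exact tendsto_const_nhds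

theorem durfeeSum_zero_one_eq {q : ℂ} (hq : ‖q‖ < 1) (N : ℕ) :
    durfeeSum q 0 1 = (∏' j : ℕ, (1 - q ^ (j + 1)))⁻¹ *
        ∑ i ∈ Finset.range N, (-1 : ℂ) ^ i * q ^ (i * (i + 1) / 2) +
      (-1 : ℂ) ^ N * q ^ (N * (N + 1) / 2) * durfeeSum q N (N + 1) := by
  induction N with
  | zero => simp
  | succ N ih =>
    have hexp : (N + 1) * (N + 1 + 1) / 2 = N * (N + 1) / 2 + (N + 1) := by
      rw [show (N + 1) * (N + 1 + 1) = N * (N + 1) + (N + 1) * 2 by ring,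
        Nat.add_mul_div_right _ _ two_pos]
    rw [ih, durfeeSum_eq_sub hq N (N + 1), durfeeSum_diag hq, Finset.sum_range_succ, hexp]
    ring

theorem norm_partialTheta_term_le {q : ℂ} (hq : ‖q‖ < 1) (n : ℕ) :
    ‖(-1 : ℂ) ^ n * q ^ (n * (n + 1) / 2)‖ ≤ ‖q‖ ^ n := by
  rw [norm_mul, norm_pow, norm_neg, norm_one, one_pow, one_mul, norm_pow]
  refine pow_le_pow_of_le_one (norm_nonneg _) hq.le ?_
  rw [Nat.le_div_iff_mul_le two_pos]
  nlinarith [Nat.le_mul_self n]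

theorem durfeeSum_zero_one {q : ℂ} (hq : ‖q‖ < 1) :
    durfeeSum q 0 1 = (∏' j : ℕ, (1 - q ^ (j + 1)))⁻¹ *
      ∑' n : ℕ, (-1 : ℂ) ^ n * q ^ (n * (n + 1) / 2) := by
  obtain ⟨C, hC⟩ := exists_norm_durfeeSum_le hq
  have hsum : Summable fun n : ℕ => (-1 : ℂ) ^ n * q ^ (n * (n + 1) / 2) :=
    .of_norm_bounded (summable_geometric_of_lt_one (norm_nonneg _) hq)
      (norm_partialTheta_term_le hq)
  have hrem : Tendsto (fun N : ℕ => (-1 : ℂ) ^ N * q ^ (N * (N + 1) / 2) * durfeeSum q N (N + 1))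
      atTop (𝓝 0) := by
    refine squeeze_zero_norm (a := fun N => ‖q‖ ^ N * C) (fun N => ?_) ?_
    · rw [norm_mul]
      exact mul_le_mul (norm_partialTheta_term_le hq N) (hC _ _) (norm_nonneg _) (by positivity)
    · simpa using (tendsto_pow_atTop_nhds_zero_of_lt_one (norm_nonneg _) hq).mul_const C
  have hlim := (hsum.hasSum.tendsto_sum_nat.const_mul
    (∏' j : ℕ, (1 - q ^ (j + 1)))⁻¹).add hrem
  simp_rw [← durfeeSum_zero_one_eq hq, add_zero] at hlim
  exact tendsto_nhds_unique tendsto_const_nhds hlim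

/-- For `‖q‖ < 1`,
`∑_{n=0}^∞ q^{n(n+1)}/(q;q)_n² = (1/(q;q)_∞) ∑_{n=0}^∞ (-1)^n q^{n(n+1)/2}`. -/
theorem crank_partial_theta (q : ℂ) (hq : ‖q‖ < 1) :
    (∑' n : ℕ, q ^ (n * (n + 1)) / (∏ j ∈ Finset.range n, (1 - q ^ (j + 1))) ^ 2) =
      (1 / ∏' j : ℕ, (1 - q ^ (j + 1))) *
        ∑' n : ℕ, (-1 : ℂ) ^ n * q ^ (n * (n + 1) / 2) := by
  rw [one_div, ← durfeeSum_zero_one hq]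
  exact tsum_congr fun n => by rw [durfeeTerm, add_zero, sq, eulerProd]
end

section
/- For |q|<1, ∑_{n=1}^∞ (q;q²)_n q^n / ((q²;q²)_n (1−q^{2n})) = ∑_{n=1}^∞ (−1)^{n−1} q^n/(1−q^n). -/
open Filter Topology

/-- The `n`-th term of `∑_{n≥1} ∏_{j=1}^n (z - p^j) / ((p;p)_n (1 - p^n))`, indexed from `0`. -/
noncomputable def shiftedTerm (p z : ℂ) (n : ℕ) : ℂ :=
  (∏ j ∈ Finset.range (n + 1), (z - p ^ (j + 1))) /
    ((∏ j ∈ Finset.range (n + 1), (1 - p ^ (j + 1))) * (1 - p ^ (n + 1)))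

lemma one_sub_ne_zero_of_norm_lt_one {w : ℂ} (hw : ‖w‖ < 1) : 1 - w ≠ 0 := by
  intro h
  rw [← sub_eq_zero.mp h] at hw
  simp at hw

lemma norm_pow_succ_lt_one {p : ℂ} (hp : ‖p‖ < 1) (n : ℕ) : ‖p ^ (n + 1)‖ < 1 := by
  rw [norm_pow]
  exact pow_lt_one₀ (norm_nonneg _) hp n.succ_ne_zero

lemma prod_one_sub_pow_succ_ne_zero {p : ℂ} (hp : ‖p‖ < 1) (n : ℕ) :
    ∏ j ∈ Finset.range n, (1 - p ^ (j + 1)) ≠ 0 :=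
  Finset.prod_ne_zero_iff.mpr fun j _ =>
    one_sub_ne_zero_of_norm_lt_one (norm_pow_succ_lt_one hp j)

lemma summable_prod_add_div_one_sub {r s : ℝ} (hr : 0 < r) (hr1 : r < 1) (hs : 0 ≤ s)
    (hs1 : s < 1) :
    Summable fun n : ℕ => ∏ j ∈ Finset.range n, ((r + s ^ (j + 1)) / (1 - s ^ (j + 1))) := by
  have hpos (j : ℕ) : 0 < (r + s ^ (j + 1)) / (1 - s ^ (j + 1)) :=
    div_pos (by positivity) (sub_pos.mpr (pow_lt_one₀ hs hs1 j.succ_ne_zero))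
  have hprod (n : ℕ) : 0 < ∏ j ∈ Finset.range n, ((r + s ^ (j + 1)) / (1 - s ^ (j + 1))) :=
    Finset.prod_pos fun j _ => hpos j
  refine summable_of_ratio_test_tendsto_lt_one hr1 (.of_forall fun n => (hprod n).ne') ?_
  have hratio (n : ℕ) :
      ‖∏ j ∈ Finset.range (n + 1), ((r + s ^ (j + 1)) / (1 - s ^ (j + 1)))‖ /
        ‖∏ j ∈ Finset.range n, ((r + s ^ (j + 1)) / (1 - s ^ (j + 1)))‖ =
      (r + s ^ (n + 1)) / (1 - s ^ (n + 1)) := by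
    rw [Real.norm_of_nonneg (hprod _).le, Real.norm_of_nonneg (hprod _).le,
      Finset.prod_range_succ, mul_div_cancel_left₀ _ (hprod n).ne']
  simp_rw [hratio]
  have hlim : Tendsto (fun n : ℕ => s ^ (n + 1)) atTop (𝓝 0) :=
    (tendsto_pow_atTop_nhds_zero_of_lt_one hs hs1).comp (tendsto_add_atTop_nat 1)
  simpa [Pi.div_def] using (hlim.const_add r).div (hlim.const_sub 1) (by norm_num)

lemma norm_prod_sub_div_prod_one_sub_le {p z : ℂ} {r : ℝ} (hp : ‖p‖ < 1) (hz : ‖z‖ ≤ r) (n : ℕ) :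
    ‖(∏ j ∈ Finset.range n, (z - p ^ (j + 1))) / ∏ j ∈ Finset.range n, (1 - p ^ (j + 1))‖ ≤
      ∏ j ∈ Finset.range n, ((r + ‖p‖ ^ (j + 1)) / (1 - ‖p‖ ^ (j + 1))) := by
  rw [← Finset.prod_div_distrib, norm_prod]
  refine Finset.prod_le_prod (fun _ _ => norm_nonneg _) fun j _ => ?_
  rw [norm_div]
  have hlt := norm_pow_succ_lt_one hp j
  have hsub := norm_sub_le z (p ^ (j + 1))
  have hrev := norm_sub_norm_le (1 : ℂ) (p ^ (j + 1))
  rw [norm_one] at hrev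
  rw [norm_pow] at hlt hsub hrev
  exact div_le_div₀ (by linarith [norm_nonneg (z - p ^ (j + 1)), norm_nonneg z])
    (by linarith) (by linarith) hrev

lemma norm_shiftedTerm_le {p z : ℂ} {r : ℝ} (hp : ‖p‖ < 1) (hz : ‖z‖ ≤ r) (n : ℕ) :
    ‖shiftedTerm p z n‖ ≤
      (∏ j ∈ Finset.range (n + 1), ((r + ‖p‖ ^ (j + 1)) / (1 - ‖p‖ ^ (j + 1)))) / (1 - ‖p‖) := by
  rw [shiftedTerm, ← div_div, norm_div]
  have hbound := norm_prod_sub_div_prod_one_sub_le hp hz (n + 1)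
  have hrev := norm_sub_norm_le (1 : ℂ) (p ^ (n + 1))
  have hpow : ‖p‖ ^ (n + 1) ≤ ‖p‖ := pow_le_of_le_one (norm_nonneg _) hp.le n.succ_ne_zero
  rw [norm_one, norm_pow] at hrev
  exact div_le_div₀ ((norm_nonneg _).trans hbound) hbound (by linarith) (by linarith)

lemma summable_shiftedTerm_bound {p : ℂ} {r : ℝ} (hp : ‖p‖ < 1) (hr : 0 < r) (hr1 : r < 1) :
    Summable fun n : ℕ =>
      (∏ j ∈ Finset.range (n + 1), ((r + ‖p‖ ^ (j + 1)) / (1 - ‖p‖ ^ (j + 1)))) / (1 - ‖p‖) :=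
  ((summable_nat_add_iff 1).mpr
    (summable_prod_add_div_one_sub hr hr1 (norm_nonneg p) hp)).div_const _

lemma exists_norm_le_lt_one {z : ℂ} (hz : ‖z‖ < 1) : ∃ r : ℝ, 0 < r ∧ r < 1 ∧ ‖z‖ ≤ r :=
  ⟨(‖z‖ + 1) / 2, by positivity, by linarith, by linarith⟩

lemma summable_shiftedTerm {p z : ℂ} (hp : ‖p‖ < 1) (hz : ‖z‖ < 1) :
    Summable (shiftedTerm p z) := by
  obtain ⟨r, hr, hr1, hzr⟩ := exists_norm_le_lt_one hz
  exact .of_norm_bounded (summable_shiftedTerm_bound hp hr hr1) (norm_shiftedTerm_le hp hzr)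

lemma prod_mul_sub_pow_succ (p z : ℂ) (n : ℕ) :
    ∏ j ∈ Finset.range (n + 1), (z * p - p ^ (j + 1)) =
      p ^ (n + 1) * (z - 1) * ∏ j ∈ Finset.range n, (z - p ^ (j + 1)) := by
  have hfactor (j : ℕ) : z * p - p ^ (j + 1) = p * (z - p ^ j) := by ring
  simp_rw [hfactor]
  rw [Finset.prod_mul_distrib, Finset.prod_const, Finset.card_range, Finset.prod_range_succ']
  ring

lemma shiftedTerm_sub_shiftedTerm_mul {p z : ℂ} (hp : ‖p‖ < 1) (hz : ‖z‖ < 1) (n : ℕ) :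
    shiftedTerm p z n - shiftedTerm p (z * p) n =
      z / (1 - z) *
        ((∏ j ∈ Finset.range n, (z - p ^ (j + 1))) / (∏ j ∈ Finset.range n, (1 - p ^ (j + 1))) -
          (∏ j ∈ Finset.range (n + 1), (z - p ^ (j + 1))) /
            ∏ j ∈ Finset.range (n + 1), (1 - p ^ (j + 1))) := by
  rw [shiftedTerm, shiftedTerm, prod_mul_sub_pow_succ, Finset.prod_range_succ,
    Finset.prod_range_succ]
  have hden := prod_one_sub_pow_succ_ne_zero hp n
  have hlast := one_sub_ne_zero_of_norm_lt_one (norm_pow_succ_lt_one hp n)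
  have hz1 := one_sub_ne_zero_of_norm_lt_one hz
  generalize ∏ j ∈ Finset.range n, (1 - p ^ (j + 1)) = D at *
  generalize ∏ j ∈ Finset.range n, (z - p ^ (j + 1)) = P at *
  generalize p ^ (n + 1) = w at *
  field_simp
  ring

lemma tsum_shiftedTerm_sub_tsum_shiftedTerm_mul {p z : ℂ} (hp : ‖p‖ < 1) (hz : ‖z‖ < 1) :
    ∑' n, shiftedTerm p z n - ∑' n, shiftedTerm p (z * p) n = z / (1 - z) := by
  have hzp : ‖z * p‖ < 1 := by
    rw [norm_mul]
    exact mul_lt_one_of_nonneg_of_lt_one_left (norm_nonneg _) hz hp.le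
  have hsum := (summable_shiftedTerm hp hz).sub (summable_shiftedTerm hp hzp)
  rw [← (summable_shiftedTerm hp hz).tsum_sub (summable_shiftedTerm hp hzp)]
  refine tendsto_nhds_unique hsum.hasSum.tendsto_sum_nat ?_
  simp_rw [shiftedTerm_sub_shiftedTerm_mul hp hz, ← Finset.mul_sum]
  simp_rw [Finset.sum_range_sub'
    (fun n => (∏ j ∈ Finset.range n, (z - p ^ (j + 1))) / ∏ j ∈ Finset.range n, (1 - p ^ (j + 1)))]
  obtain ⟨r, hr, hr1, hzr⟩ := exists_norm_le_lt_one hz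
  have hlim := squeeze_zero_norm (norm_prod_sub_div_prod_one_sub_le hp hzr)
    (summable_prod_add_div_one_sub hr hr1 (norm_nonneg p) hp).tendsto_atTop_zero
  simpa using (hlim.const_sub 1).const_mul (z / (1 - z))

lemma norm_mul_pow_le {p : ℂ} (hp : ‖p‖ < 1) (z : ℂ) (n : ℕ) : ‖z * p ^ n‖ ≤ ‖z‖ := by
  rw [norm_mul, norm_pow]
  exact mul_le_of_le_one_right (norm_nonneg _) (pow_le_one₀ (norm_nonneg _) hp.le)

lemma tsum_shiftedTerm_sub_tsum_shiftedTerm_mul_pow {p z : ℂ} (hp : ‖p‖ < 1) (hz : ‖z‖ < 1)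
    (N : ℕ) :
    ∑ k ∈ Finset.range N, z * p ^ k / (1 - z * p ^ k) =
      ∑' n, shiftedTerm p z n - ∑' n, shiftedTerm p (z * p ^ N) n := by
  have hstep (k : ℕ) := tsum_shiftedTerm_sub_tsum_shiftedTerm_mul hp
    ((norm_mul_pow_le hp z k).trans_lt hz)
  simp_rw [← hstep, mul_assoc, ← pow_succ]
  rw [Finset.sum_range_sub' (fun k => ∑' n, shiftedTerm p (z * p ^ k) n)]
  simp

lemma tendsto_sum_mul_pow_div_one_sub {p z : ℂ} (hp : ‖p‖ < 1) (hz : ‖z‖ < 1) :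
    Tendsto (fun N => ∑ k ∈ Finset.range N, z * p ^ k / (1 - z * p ^ k)) atTop
      (𝓝 (∑' n, shiftedTerm p z n - ∑' n, shiftedTerm p 0 n)) := by
  simp_rw [tsum_shiftedTerm_sub_tsum_shiftedTerm_mul_pow hp hz]
  refine Tendsto.const_sub _ ?_
  obtain ⟨r, hr, hr1, hzr⟩ := exists_norm_le_lt_one hz
  refine tendsto_tsum_of_dominated_convergence (summable_shiftedTerm_bound hp hr hr1)
    (fun n => ?_)
    (.of_forall fun N n => norm_shiftedTerm_le hp ((norm_mul_pow_le hp z N).trans hzr) n)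
  have hcont : Continuous fun w => shiftedTerm p w n := by
    unfold shiftedTerm
    fun_prop
  have hlim : Tendsto (fun N : ℕ => z * p ^ N) atTop (𝓝 0) := by
    simpa using (tendsto_pow_atTop_nhds_zero_of_norm_lt_one hp).const_mul z
  exact (hcont.tendsto 0).comp hlim

lemma tsum_shiftedTerm_self (p : ℂ) : ∑' n, shiftedTerm p p n = 0 := by
  have hzero (n : ℕ) : shiftedTerm p p n = 0 := by
    rw [shiftedTerm, Finset.prod_eq_zero (Finset.mem_range.mpr n.succ_pos) (by simp), zero_div]
  simp [hzero]

lemma shiftedTerm_sq (q : ℂ) (n : ℕ) :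
    shiftedTerm (q ^ 2) q n = (∏ j ∈ Finset.range (n + 1), (1 - q ^ (2 * j + 1))) * q ^ (n + 1) /
      ((∏ j ∈ Finset.range (n + 1), (1 - q ^ (2 * j + 2))) * (1 - q ^ (2 * (n + 1)))) := by
  have hfactor (j : ℕ) : q - (q ^ 2) ^ (j + 1) = (1 - q ^ (2 * j + 1)) * q := by ring
  simp_rw [shiftedTerm, hfactor, Finset.prod_mul_distrib, Finset.prod_const, Finset.card_range,
    ← pow_mul, mul_add]

lemma summable_alternating_lambert {q : ℂ} (hq : ‖q‖ < 1) :
    Summable fun n : ℕ => (-1 : ℂ) ^ n * q ^ (n + 1) / (1 - q ^ (n + 1)) := by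
  refine .of_norm_bounded (g := fun n => ‖q‖ ^ (n + 1) / (1 - ‖q‖))
    (((summable_nat_add_iff 1).mpr
      (summable_geometric_of_lt_one (norm_nonneg q) hq)).div_const _) fun n => ?_
  have hrev := norm_sub_norm_le (1 : ℂ) (q ^ (n + 1))
  have hpow : ‖q‖ ^ (n + 1) ≤ ‖q‖ := pow_le_of_le_one (norm_nonneg _) hq.le n.succ_ne_zero
  rw [norm_one, norm_pow] at hrev
  rw [norm_div, norm_mul, norm_pow, norm_neg, norm_one, one_pow, one_mul, norm_pow]
  exact div_le_div_of_nonneg_left (by positivity) (by linarith) (by linarith)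

lemma sum_range_two_mul_alternating_lambert (q : ℂ) (N : ℕ) :
    ∑ n ∈ Finset.range (2 * N), (-1 : ℂ) ^ n * q ^ (n + 1) / (1 - q ^ (n + 1)) =
      ∑ k ∈ Finset.range N, q * (q ^ 2) ^ k / (1 - q * (q ^ 2) ^ k) -
        ∑ k ∈ Finset.range N, q ^ 2 * (q ^ 2) ^ k / (1 - q ^ 2 * (q ^ 2) ^ k) := by
  induction N with
  | zero => simp
  | succ N ih =>
    rw [mul_add, mul_one, Finset.sum_range_succ, Finset.sum_range_succ, ih,
      Finset.sum_range_succ, Finset.sum_range_succ]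
    have hodd : q * (q ^ 2) ^ N = q ^ (2 * N + 1) := by ring
    have heven : q ^ 2 * (q ^ 2) ^ N = q ^ (2 * N + 1 + 1) := by ring
    rw [hodd, heven, pow_succ (-1 : ℂ), pow_mul (-1 : ℂ), neg_one_sq, one_pow]
    ring

/-- For `‖q‖ < 1`,
`∑_{n=1}^∞ (q;q²)_n q^n / ((q²;q²)_n (1-q^{2n})) = ∑_{n=1}^∞ (-1)^{n-1} q^n/(1-q^n)`. -/
theorem odd_qfact_alt_lambert (q : ℂ) (hq : ‖q‖ < 1) :
    (∑' n : ℕ, (∏ j ∈ Finset.range (n + 1), (1 - q ^ (2 * j + 1))) * q ^ (n + 1) /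
        ((∏ j ∈ Finset.range (n + 1), (1 - q ^ (2 * j + 2))) * (1 - q ^ (2 * (n + 1))))) =
      ∑' n : ℕ, (-1 : ℂ) ^ n * q ^ (n + 1) / (1 - q ^ (n + 1)) := by
  simp_rw [← shiftedTerm_sq]
  have hp : ‖q ^ 2‖ < 1 := norm_pow_succ_lt_one hq 1
  have hdiff := (tendsto_sum_mul_pow_div_one_sub hp hq).sub
    (tendsto_sum_mul_pow_div_one_sub hp hp)
  simp_rw [← sum_range_two_mul_alternating_lambert, tsum_shiftedTerm_self] at hdiff
  have hlambert := (summable_alternating_lambert hq).hasSum.tendsto_sum_nat.comp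
    (tendsto_id.const_mul_atTop' (two_pos : (0 : ℕ) < 2))
  simpa using tendsto_nhds_unique hdiff hlambert
end
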